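/- Let A be a ring and J a two-sided ideal of A, and let Y and V be left A/J-modules, regarded also as A-modules by restriction along the quotient map A → A/J. Let m ≥ 0 and suppose there is an exact sequence of A/J-modules 0 → K → M_m → M_{m-1} → ⋯ → M_1 → M_0 → Y → 0 in which each M_i (0 ≤ i ≤ m) is projective both as an A/J-module and as an A-module. Then there is an injective homomorphism of abelian groups Ext^{m+2}_{A/J}(Y, V) → Ext^{m+2}_A(Y, V). -/

import Mathlib

open CategoryTheory

noncomputable section

namespace CategoryTheory

open Limits Abelian

universe w w' v v' u u'

variable {C : Type u} [Category.{v} C] [Abelian C]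

namespace ProjectiveResolution

variable [Linear ℤ C] {X : C} (P : ProjectiveResolution X) (Y : C) (n : ℕ)

lemma d_comp_iCycles (z : (P.complex.linearYonedaObj ℤ Y).cycles n) :
    letI f : P.complex.X n ⟶ Y := (P.complex.linearYonedaObj ℤ Y).iCycles n z
    P.complex.d (n + 1) n ≫ f = 0 :=
  ConcreteCategory.congr_hom ((P.complex.linearYonedaObj ℤ Y).iCycles_d n (n + 1)) z

variable [HasExt.{w} C]

/-- Cocycles in `Hom(P, Y)` represent classes in `Ext X Y n`. -/
def cyclesToExt : (P.complex.linearYonedaObj ℤ Y).cycles n →+ Abelian.Ext X Y n :=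
  AddMonoidHom.mk' (fun z ↦ P.extMk ((P.complex.linearYonedaObj ℤ Y).iCycles n z) (n + 1) rfl
    (P.d_comp_iCycles Y n z))
    (fun a b ↦ by
      refine Eq.trans ?_ (P.add_extMk _ _ _ _ _ _).symm
      congr 1
      exact map_add _ _ _)

lemma cyclesToExt_surjective : Function.Surjective (P.cyclesToExt Y n) := by
  intro α
  obtain ⟨f, hf, rfl⟩ := P.extMk_surjective α (n + 1) rfl
  have hex := ShortComplex.exact_of_f_is_kernel
    (ShortComplex.mk _ _ ((P.complex.linearYonedaObj ℤ Y).iCycles_d n (n + 1)))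
    ((P.complex.linearYonedaObj ℤ Y).cyclesIsKernel n (n + 1) (by simp))
  obtain ⟨z, hz⟩ := (ShortComplex.moduleCat_exact_iff _).1 hex f hf
  refine ⟨z, ?_⟩
  simp only [cyclesToExt, AddMonoidHom.mk'_apply]
  congr 1

lemma cyclesToExt_succ_eq_zero_iff (z : (P.complex.linearYonedaObj ℤ Y).cycles (n + 1)) :
    P.cyclesToExt Y (n + 1) z = 0 ↔ (P.complex.linearYonedaObj ℤ Y).homologyπ (n + 1) z = 0 := by
  let L := P.complex.linearYonedaObj ℤ Y
  have hcomp (g : L.X n) : L.iCycles (n + 1) (L.toCycles n (n + 1) g) = L.d n (n + 1) g :=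
    ConcreteCategory.congr_hom (L.toCycles_i n (n + 1)) g
  have hex := ShortComplex.exact_of_g_is_cokernel
    (ShortComplex.mk _ _ (L.toCycles_comp_homologyπ n (n + 1)))
    (L.homologyIsCokernel n (n + 1) (by simp))
  refine (P.extMk_eq_zero_iff _ (n + 2) rfl (P.d_comp_iCycles Y (n + 1) z) n rfl).trans
    ⟨fun ⟨g, hg⟩ ↦ ?_, fun h ↦ ?_⟩
  · have hz : L.toCycles n (n + 1) g = z :=
      (ModuleCat.mono_iff_injective (L.iCycles (n + 1))).1 inferInstance ((hcomp g).trans hg)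
    rw [← hz]
    exact ConcreteCategory.congr_hom (L.toCycles_comp_homologyπ n (n + 1)) g
  · obtain ⟨g, hg⟩ := (ShortComplex.moduleCat_exact_iff _).1 hex z h
    refine ⟨g, ?_⟩
    rw [← hg]
    exact (hcomp g).symm

/-- In positive degrees, `Ext` groups in the derived category are the cohomology of
`Hom(P, Y)` for a projective resolution `P`. -/
def homologyAddEquivExt :
    (P.complex.linearYonedaObj ℤ Y).homology (n + 1) ≃+ Abelian.Ext X Y (n + 1) :=
  let π := ((P.complex.linearYonedaObj ℤ Y).homologyπ (n + 1)).hom.toAddMonoidHom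
  (QuotientAddGroup.quotientKerEquivOfSurjective π
    ((ModuleCat.epi_iff_surjective _).1 inferInstance)).symm.trans
    ((QuotientAddGroup.quotientAddEquivOfEq (by
      ext z
      exact (P.cyclesToExt_succ_eq_zero_iff Y n z).symm)).trans
    (QuotientAddGroup.quotientKerEquivOfSurjective _ (P.cyclesToExt_surjective Y (n + 1))))

end ProjectiveResolution

/-- In positive degrees, the `Ext` groups obtained by deriving `Hom(-, Y)` agree with those
defined by morphisms in the derived category. -/
def leftDerivedExtAddEquivExt [Linear ℤ C] [EnoughProjectives C] [HasExt.{w} C]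
    (X Y : C) (n : ℕ) :
    ((_root_.Ext ℤ C (n + 1)).obj (Opposite.op X)).obj Y ≃+ Abelian.Ext X Y (n + 1) :=
  ((projectiveResolution X).isoExt (n + 1) Y).toLinearEquiv.toAddEquiv.trans
    ((projectiveResolution X).homologyAddEquivExt Y n)

variable {D : Type u'} [Category.{v'} D] [Abelian D] [HasExt.{w} C] [HasExt.{w'} D]
  (F : C ⥤ D) [F.Additive] [PreservesFiniteLimits F] [PreservesFiniteColimits F]

namespace Functor

lemma mapExtAddHom_one_injective [F.Full] [F.Faithful] [EnoughProjectives C] (X Y : C) :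
    Function.Injective (F.mapExtAddHom X Y 1) := by
  rw [injective_iff_map_eq_zero]
  intro x hx
  let P : ProjectivePresentation X := Classical.arbitrary _
  let S := ShortComplex.mk _ _ (kernel.condition P.f)
  have : Projective S.X₂ := P.projective
  have hS : S.ShortExact := { exact := ShortComplex.exact_kernel P.f }
  obtain ⟨x₁, rfl⟩ := Ext.contravariant_sequence_exact₃ hS Y x
    (Ext.eq_zero_of_projective _) (add_comm 1 0)
  obtain ⟨f, rfl⟩ := (Ext.mk₀_bijective _ _).2 x₁
  rw [mapExtAddHom_apply, Ext.mapExactFunctor_comp, Ext.mapExactFunctor_extClass] at hx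
  obtain ⟨y, hy⟩ := Ext.contravariant_sequence_exact₁ (hS.map F) (F.obj Y) _ _ hx
  obtain ⟨g, rfl⟩ := (Ext.mk₀_bijective _ _).2 y
  obtain ⟨g, rfl⟩ := F.map_surjective g
  rw [Ext.mapExactFunctor_mk₀] at hy
  have hf : f = S.f ≫ g := F.map_injective (by
    rw [F.map_comp]
    exact (Ext.mk₀_bijective _ _).1 (hy.symm.trans (Ext.mk₀_comp_mk₀ _ _)))
  rw [hf, ← Ext.mk₀_comp_mk₀, hS.extClass_comp_assoc]

lemma mapExtAddHom_injective_of_shortExact {S : ShortComplex C} (hS : S.ShortExact)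
    [Projective S.X₂] [Projective (F.obj S.X₂)] (Y : C) (n : ℕ)
    (h : Function.Injective (F.mapExtAddHom S.X₁ Y (n + 1))) :
    Function.Injective (F.mapExtAddHom S.X₃ Y (n + 2)) := by
  have := hS.mono_f
  have := hS.epi_g
  rw [injective_iff_map_eq_zero] at h ⊢
  intro x hx
  obtain ⟨x₁, rfl⟩ := Ext.contravariant_sequence_exact₃ hS Y x
    (Ext.eq_zero_of_projective _) (add_comm 1 (n + 1))
  rw [mapExtAddHom_apply, Ext.mapExactFunctor_comp, Ext.mapExactFunctor_extClass] at hx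
  obtain ⟨y, hy⟩ := Ext.contravariant_sequence_exact₁ (hS.map F) (F.obj Y) _ _ hx
  have : Projective (S.map F).X₂ := ‹Projective (F.obj S.X₂)›
  obtain rfl := Ext.eq_zero_of_projective y
  rw [h x₁ (hy.symm.trans (Ext.comp_zero _ _ _ _ _)), Ext.comp_zero]

/-- Dimension shifting along `M_m → ⋯ → M_0 → X → 0` whose terms remain projective under `F`. -/
lemma mapExtAddHom_injective_of_exact [F.Full] [F.Faithful] [EnoughProjectives C]
    (Y : C) (m : ℕ) (X : C) (N : ℕ → C) (d : ∀ i : ℕ, N (i + 1) ⟶ N i) (ε : N 0 ⟶ X)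
    [Epi ε] (hε : d 0 ≫ ε = 0) (hex₀ : 0 < m → (ShortComplex.mk _ _ hε).Exact)
    (hd : ∀ i < m, d (i + 1) ≫ d i = 0)
    (hex : ∀ (i : ℕ) (hi : i + 1 < m), (ShortComplex.mk _ _ (hd i (by lia))).Exact)
    (hproj : ∀ i ≤ m, Projective (N i)) (hprojF : ∀ i ≤ m, Projective (F.obj (N i))) :
    Function.Injective (F.mapExtAddHom X Y (m + 2)) := by
  have hS {M X : C} (ε : M ⟶ X) [Epi ε] :
      (ShortComplex.mk _ _ (kernel.condition ε)).ShortExact :=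
    { exact := ShortComplex.exact_kernel ε }
  induction m generalizing X N with
  | zero =>
    have := hproj 0 le_rfl
    have := hprojF 0 le_rfl
    exact F.mapExtAddHom_injective_of_shortExact (hS ε) Y 0 (F.mapExtAddHom_one_injective _ _)
  | succ m ih =>
    have := hproj 0 (by lia)
    have := hprojF 0 (by lia)
    refine F.mapExtAddHom_injective_of_shortExact (hS ε) Y (m + 1) ?_
    let ε' : N 1 ⟶ Limits.kernel ε := kernel.lift ε (d 0) hε
    have hε' : d 1 ≫ ε' = 0 := by
      rw [← cancel_mono (kernel.ι ε), Category.assoc, kernel.lift_ι, zero_comp]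
      exact hd 0 (by lia)
    have : Epi ε' := (ShortComplex.exact_iff_epi_kernel_lift _).1 (hex₀ (by lia))
    refine ih (Limits.kernel ε) (fun i ↦ N (i + 1)) (fun i ↦ d (i + 1)) ε' hε'
      (fun hm ↦ ?_) (fun i hi ↦ hd (i + 1) (by lia)) (fun i hi ↦ hex (i + 1) (by lia))
      (fun i hi ↦ hproj (i + 1) (by lia)) (fun i hi ↦ hprojF (i + 1) (by lia))
    let φ : ShortComplex.mk _ _ hε' ⟶ ShortComplex.mk _ _ (hd 0 (by lia)) :=
      { τ₁ := 𝟙 _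
        τ₂ := 𝟙 _
        τ₃ := kernel.ι ε }
    have : Epi φ.τ₁ := inferInstanceAs (Epi (𝟙 _))
    have : IsIso φ.τ₂ := inferInstanceAs (IsIso (𝟙 _))
    have : Mono φ.τ₃ := inferInstanceAs (Mono (kernel.ι ε))
    exact (ShortComplex.exact_iff_of_epi_of_isIso_of_mono φ).2 (hex 0 (by lia))

end Functor
end CategoryTheory

namespace ModuleCat

variable {R S : Type} [Ring R] [Ring S] (f : R →+* S)

instance : Limits.PreservesFiniteLimits (restrictScalars.{0} f) where
  preservesFiniteLimits _ _ _ := ⟨inferInstance⟩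

lemma full_restrictScalars (hf : Function.Surjective f) : (restrictScalars.{0} f).Full where
  map_surjective {M N} g := ⟨ofHom
    { toFun := g.hom
      map_add' := g.hom.map_add
      map_smul' := fun s x ↦ by
        obtain ⟨r, rfl⟩ := hf s
        exact g.hom.map_smul r x }, rfl⟩

end ModuleCat

/-- let `J` be a two-sided ideal of a ring `A`, and `Y`, `V` left
`A/J`-modules, regarded as `A`-modules by restriction along `A → A/J`.  Suppose
there is an exact sequence of `A/J`-modules
`0 → K → M_m → ⋯ → M_1 → M_0 → Y → 0` in which each `M_i` (`0 ≤ i ≤ m`) is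
projective both over `A/J` and over `A`.  (Below, `N i = M_i` for `i ≤ m` and
`N (m+1) = K`.)  Then there is an injective homomorphism of abelian groups
`Ext^{m+2}_{A/J}(Y, V) → Ext^{m+2}_A(Y, V)`. -/
theorem ext_quotient_injective
    {A : Type} [Ring A] (J : TwoSidedIdeal A) (m : ℕ)
    (Y V : ModuleCat J.ringCon.Quotient)
    (N : ℕ → ModuleCat J.ringCon.Quotient)
    (d : ∀ i : ℕ, N (i + 1) ⟶ N i) (ε : N 0 ⟶ Y)
    (hε : Function.Surjective ε)
    (hex0 : Function.Exact (d 0) ε)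
    (hex : ∀ i : ℕ, i < m → Function.Exact (d (i + 1)) (d i))
    (hK : Function.Injective (d m))
    (hproj : ∀ i : ℕ, i ≤ m → Projective (N i))
    (hprojA : ∀ i : ℕ, i ≤ m →
      Projective ((ModuleCat.restrictScalars J.ringCon.mk').obj (N i))) :
    ∃ φ : (((Ext ℤ (ModuleCat J.ringCon.Quotient) (m + 2)).obj
            (Opposite.op Y)).obj V) →+
          (((Ext ℤ (ModuleCat A) (m + 2)).obj
              (Opposite.op ((ModuleCat.restrictScalars J.ringCon.mk').obj Y))).obj
            ((ModuleCat.restrictScalars J.ringCon.mk').obj V)),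
      Function.Injective φ := by
  let F := ModuleCat.restrictScalars.{0} J.ringCon.mk'
  have : F.Full := ModuleCat.full_restrictScalars _ J.ringCon.mk'_surjective
  have : Epi ε := (ModuleCat.epi_iff_surjective ε).2 hε
  have hw {X Y Z : ModuleCat J.ringCon.Quotient} {f : X ⟶ Y} {g : Y ⟶ Z}
      (h : Function.Exact f g) : f ≫ g = 0 := by
    ext x
    exact h.apply_apply_eq_zero x
  have hinj := F.mapExtAddHom_injective_of_exact V m Y N d ε (hw hex0)
    (fun _ ↦ (ShortComplex.ShortExact.moduleCat_exact_iff_function_exact _).2 hex0)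
    (fun i hi ↦ hw (hex i hi))
    (fun i hi ↦ (ShortComplex.ShortExact.moduleCat_exact_iff_function_exact _).2
      (hex i (by lia)))
    hproj hprojA
  let e₁ := leftDerivedExtAddEquivExt Y V (m + 1)
  let e₂ := leftDerivedExtAddEquivExt (F.obj Y) (F.obj V) (m + 1)
  exact ⟨e₂.symm.toAddMonoidHom.comp ((F.mapExtAddHom Y V (m + 2)).comp e₁.toAddMonoidHom),
    e₂.symm.injective.comp (hinj.comp e₁.injective)⟩
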